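/- Let (X,b,μ) be a weighted graph satisfying (FC), U, W : X → ℝ with U ≥ 0 and W ≥ 0, and suppose there are constants c₁ ≥ 0 and c₂ ≥ 0 with |∇W|²(x) ≤ c₁ + c₂·W(x) for all x ∈ X. Then for all u ∈ C_c(X): ‖L_U u‖² + ‖(W+1)u‖² ≤ ‖(L_U + W + 1)u‖² + (c₁ + c₂)·‖u‖², where all norms are taken in ℓ²(X,μ) and (L_U + W + 1)u denotes L_U u + (W+1)·u. -/

import Mathlib

open scoped ENNReal

noncomputable section

/-- The formal discrete Schrödinger operator
`(L_U f)(x) = μ(x)⁻¹ ∑_y b(x,y)(f(x) − f(y)) + U(x) f(x)`. -/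
def lapV {X : Type*} (b : X → X → ℝ) (μ : X → ℝ) (U : X → ℝ) (f : X → ℂ) (x : X) : ℂ :=
  (μ x : ℂ)⁻¹ * ∑' y, (b x y : ℂ) * (f x - f y) + (U x : ℂ) * f x

/-- The squared gradient `|∇W|²(x) = μ(x)⁻¹ ∑_y b(x,y)(W(x)−W(y))²`, computed in `ℝ≥0∞`. -/
def gradSq {X : Type*} (b : X → X → ℝ) (μ : X → ℝ) (W : X → ℝ) (x : X) : ℝ≥0∞ :=
  (ENNReal.ofReal (μ x))⁻¹ * ∑' y, ENNReal.ofReal (b x y * (W x - W y) ^ 2)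

lemma aux_pt (V V' p q : ℝ) (hV : 0 < V) (hV' : 0 < V') :
    0 ≤ V * (p ^ 2 - p * q) + V' * (q ^ 2 - q * p) + (V - V') ^ 2 / V * p ^ 2 / 2
      + (V' - V) ^ 2 / V' * q ^ 2 / 2 := by
  have e : V * (p ^ 2 - p * q) + V' * (q ^ 2 - q * p) + (V - V') ^ 2 / V * p ^ 2 / 2
      + (V' - V) ^ 2 / V' * q ^ 2 / 2
      = V / 2 * (p - q + (V - V') * p / (2 * V)) ^ 2
        + V' / 2 * (p - q + (V - V') * q / (2 * V')) ^ 2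
        + 3 / 8 * ((V - V') ^ 2 / V * p ^ 2) + 3 / 8 * ((V' - V) ^ 2 / V' * q ^ 2) := by
    field_simp
    ring
  rw [e]
  positivity

lemma aux_tsum {X : Type*} (b : X → X → ℝ) (hb_sum : ∀ x, Summable fun z => b x z)
    (u : X → ℂ) (K : Finset X) (hK : ∀ x, x ∉ K → u x = 0) (x : X) :
    ∑' y, (b x y : ℂ) * (u x - u y)
      = ((∑' y, b x y : ℝ) : ℂ) * u x - ∑ y ∈ K, (b x y : ℂ) * u y := by
  have h1 : Summable fun y => (b x y : ℂ) * u x :=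
    (Complex.ofRealCLM.summable (hb_sum x)).mul_right _
  have h0 : ∀ y, y ∉ K → (b x y : ℂ) * u y = 0 := fun y hy => by simp [hK y hy]
  have h2 : Summable fun y => (b x y : ℂ) * u y := summable_of_ne_finset_zero h0
  have h3 := tsum_eq_sum (L := SummationFilter.unconditional X) h0
  rw [← h3, Complex.ofReal_tsum, ← tsum_mul_right, ← h1.tsum_sub h2]
  exact tsum_congr fun y => by ring

lemma aux_summable {X : Type*} (b : X → X → ℝ) (μ U : X → ℝ)
    (hb_symm : ∀ x y, b x y = b y x)
    (hb_sum : ∀ x, Summable fun z => b x z)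
    (hμ_pos : ∀ x, 0 < μ x)
    (hFC : ∀ x, Summable fun y => μ y * (b x y / μ y) ^ 2)
    (u : X → ℂ) (K : Finset X) (hK : ∀ x, x ∉ K → u x = 0) :
    Summable fun x => μ x * ‖lapV b μ U u x‖ ^ 2 := by
  have hG : Summable fun x => μ x * ‖(μ x : ℂ)⁻¹ * ∑ y ∈ K, (b x y : ℂ) * u y‖ ^ 2 := by
    have hS : Summable fun x => ∑ y ∈ K, (K.card * ‖u y‖ ^ 2) * (μ x * (b y x / μ x) ^ 2) :=
      summable_sum fun y _ => (hFC y).mul_left _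
    refine Summable.of_nonneg_of_le (fun x => ?_) (fun x => ?_) hS
    · have := hμ_pos x
      positivity
    · have hx := hμ_pos x
      have h1 : ‖(μ x : ℂ)⁻¹ * ∑ y ∈ K, (b x y : ℂ) * u y‖ ≤ ∑ y ∈ K, |b y x / μ x| * ‖u y‖ := by
        rw [Finset.mul_sum]
        refine (norm_sum_le _ _).trans (Finset.sum_le_sum fun y _ => le_of_eq ?_)
        rw [norm_mul, norm_mul, norm_inv, Complex.norm_real, Complex.norm_real, hb_symm x y,
          abs_div, Real.norm_eq_abs, Real.norm_eq_abs]
        ring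
      have h2 : ‖(μ x : ℂ)⁻¹ * ∑ y ∈ K, (b x y : ℂ) * u y‖ ^ 2
          ≤ K.card * ∑ y ∈ K, (|b y x / μ x| * ‖u y‖) ^ 2 :=
        (pow_le_pow_left₀ (norm_nonneg _) h1 2).trans sq_sum_le_card_mul_sum_sq
      refine (mul_le_mul_of_nonneg_left h2 hx.le).trans (le_of_eq ?_)
      rw [Finset.mul_sum, Finset.mul_sum]
      refine Finset.sum_congr rfl fun y _ => ?_
      rw [mul_pow, sq_abs]
      ring
  refine (summable_congr_cofinite ?_).mp hG
  have : ∀ᶠ x in Filter.cofinite, x ∉ K := K.finite_toSet.eventually_cofinite_notMem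
  filter_upwards [this] with x hx
  simp only [lapV]
  rw [aux_tsum b hb_sum u K hK x, hK x hx]
  simp

lemma aux_point {X : Type*} (b : X → X → ℝ) (μ U W : X → ℝ)
    (hb_nonneg : ∀ x y, 0 ≤ b x y)
    (hb_sum : ∀ x, Summable fun z => b x z)
    (hμ_pos : ∀ x, 0 < μ x)
    (hU : ∀ x, 0 ≤ U x) (hW : ∀ x, 0 ≤ W x)
    (u : X → ℂ) (K : Finset X) (hK : ∀ x, x ∉ K → u x = 0) (x : X) :
    μ x * ‖lapV b μ U u x‖ ^ 2 + μ x * ‖((W x + 1 : ℝ) : ℂ) * u x‖ ^ 2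
      + 2 * ∑ y ∈ K, b x y * ((W x + 1) * (‖u x‖ ^ 2 - ‖u x‖ * ‖u y‖))
    ≤ μ x * ‖lapV b μ U u x + ((W x + 1 : ℝ) : ℂ) * u x‖ ^ 2 := by
  have hx := hμ_pos x
  have hV : 0 < W x + 1 := by linarith [hW x]
  have key : ∑ y ∈ K, b x y * ((W x + 1) * (‖u x‖ ^ 2 - ‖u x‖ * ‖u y‖))
      ≤ μ x * (lapV b μ U u x * (starRingEnd ℂ) (((W x + 1 : ℝ) : ℂ) * u x)).re := by
    have hB : ∑ y ∈ K, b x y ≤ ∑' y, b x y := (hb_sum x).sum_le_tsum K fun y _ => hb_nonneg x y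
    have e : (μ x : ℂ) * (lapV b μ U u x * (starRingEnd ℂ) (((W x + 1 : ℝ) : ℂ) * u x))
        = (((W x + 1) * ((∑' y, b x y) * ‖u x‖ ^ 2) + μ x * U x * (W x + 1) * ‖u x‖ ^ 2 : ℝ) : ℂ)
          - ((W x + 1 : ℝ) : ℂ) * ∑ y ∈ K, (b x y : ℂ) * (u y * (starRingEnd ℂ) (u x)) := by
      have hn : u x * (starRingEnd ℂ) (u x) = ((‖u x‖ ^ 2 : ℝ) : ℂ) := by
        rw [Complex.mul_conj, Complex.normSq_eq_norm_sq]
      have hs : ∑ y ∈ K, (b x y : ℂ) * (u y * (starRingEnd ℂ) (u x))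
          = (∑ y ∈ K, (b x y : ℂ) * u y) * (starRingEnd ℂ) (u x) := by
        rw [Finset.sum_mul]
        exact Finset.sum_congr rfl fun y _ => by ring
      have hm : (μ x : ℂ) ≠ 0 := by exact_mod_cast hx.ne'
      rw [hs]
      simp only [lapV]
      rw [aux_tsum b hb_sum u K hK x, map_mul, Complex.conj_ofReal]
      generalize ∑ y ∈ K, (b x y : ℂ) * u y = S
      generalize ∑' y, b x y = B
      generalize ‖u x‖ ^ 2 = N at hn ⊢
      generalize W x + 1 = V
      push_cast
      rw [← hn]
      field_simp
      ring
    have e2 := congrArg Complex.re e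
    rw [Complex.re_ofReal_mul, Complex.sub_re, Complex.ofReal_re, Complex.re_ofReal_mul,
      Complex.re_sum] at e2
    rw [e2]
    have h3 : ∑ y ∈ K, ((b x y : ℂ) * (u y * (starRingEnd ℂ) (u x))).re
        ≤ ∑ y ∈ K, b x y * (‖u x‖ * ‖u y‖) := by
      refine Finset.sum_le_sum fun y _ => ?_
      rw [Complex.re_ofReal_mul]
      refine mul_le_mul_of_nonneg_left ?_ (hb_nonneg x y)
      refine (Complex.re_le_norm _).trans (le_of_eq ?_)
      rw [norm_mul, Complex.norm_conj, mul_comm]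
    have h4 : ∑ y ∈ K, b x y * ((W x + 1) * (‖u x‖ ^ 2 - ‖u x‖ * ‖u y‖))
        = (W x + 1) * ((∑ y ∈ K, b x y) * ‖u x‖ ^ 2)
          - (W x + 1) * ∑ y ∈ K, b x y * (‖u x‖ * ‖u y‖) := by
      rw [Finset.sum_mul, Finset.mul_sum, Finset.mul_sum, ← Finset.sum_sub_distrib]
      exact Finset.sum_congr rfl fun y _ => by ring
    rw [h4]
    have h5 := mul_le_mul_of_nonneg_left h3 hV.le
    have h6 := mul_le_mul_of_nonneg_left
      (mul_le_mul_of_nonneg_right hB (sq_nonneg ‖u x‖)) hV.le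
    have h7 : 0 ≤ μ x * U x * (W x + 1) * ‖u x‖ ^ 2 := by
      have := hU x
      positivity
    linarith
  have hn : ‖lapV b μ U u x + ((W x + 1 : ℝ) : ℂ) * u x‖ ^ 2
      = ‖lapV b μ U u x‖ ^ 2 + ‖((W x + 1 : ℝ) : ℂ) * u x‖ ^ 2
        + 2 * (lapV b μ U u x * (starRingEnd ℂ) (((W x + 1 : ℝ) : ℂ) * u x)).re := by
    simp only [← Complex.normSq_eq_norm_sq]
    exact Complex.normSq_add _ _
  rw [hn]
  linarith

lemma aux_grad {X : Type*} (b : X → X → ℝ) (μ W : X → ℝ)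
    (hb_nonneg : ∀ x y, 0 ≤ b x y)
    (hμ_pos : ∀ x, 0 < μ x)
    (hW : ∀ x, 0 ≤ W x)
    (c₁ c₂ : ℝ) (hc₁ : 0 ≤ c₁) (hc₂ : 0 ≤ c₂)
    (hgrad : ∀ x, gradSq b μ W x ≤ ENNReal.ofReal (c₁ + c₂ * W x)) (K : Finset X) (x : X) :
    ∑ y ∈ K, b x y * (((W x + 1) - (W y + 1)) ^ 2 / (W x + 1)) ≤ (c₁ + c₂) * μ x := by
  have hx := hμ_pos x
  have hWx := hW x
  have hV : 0 < W x + 1 := by linarith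
  have hc : 0 ≤ c₁ + c₂ * W x := by positivity
  have h1 : ∑ y ∈ K, b x y * (W x - W y) ^ 2 ≤ μ x * (c₁ + c₂ * W x) := by
    have h := hgrad x
    simp only [gradSq] at h
    have hne : ENNReal.ofReal (μ x) ≠ 0 := by simpa using hx
    have h' : ∑' y, ENNReal.ofReal (b x y * (W x - W y) ^ 2)
        ≤ ENNReal.ofReal (μ x) * ENNReal.ofReal (c₁ + c₂ * W x) := by
      have := mul_le_mul_right h (ENNReal.ofReal (μ x))
      rwa [← mul_assoc, ENNReal.mul_inv_cancel hne ENNReal.ofReal_ne_top, one_mul] at this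
    have h2 := (ENNReal.sum_le_tsum K).trans h'
    rw [← ENNReal.ofReal_sum_of_nonneg
      (fun y _ => mul_nonneg (hb_nonneg x y) (sq_nonneg _)), ← ENNReal.ofReal_mul hx.le] at h2
    exact (ENNReal.ofReal_le_ofReal_iff (by positivity)).mp h2
  have h2 : ∑ y ∈ K, b x y * (((W x + 1) - (W y + 1)) ^ 2 / (W x + 1))
      = (∑ y ∈ K, b x y * (W x - W y) ^ 2) / (W x + 1) := by
    rw [Finset.sum_div]
    exact Finset.sum_congr rfl fun y _ => by rw [add_sub_add_right_eq_sub]; ring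
  rw [h2, div_le_iff₀ hV]
  refine h1.trans ?_
  have : 0 ≤ μ x * (c₁ * W x + c₂) := by positivity
  linarith

/-- Let `(X,b,μ)` be a weighted graph satisfying (FC), `U, W : X → ℝ` with
`U ≥ 0` and `W ≥ 0`, and suppose there are constants `c₁ ≥ 0` and `c₂ ≥ 0` with
`|∇W|²(x) ≤ c₁ + c₂·W(x)` for all `x`.  Then for all `u ∈ C_c(X)`:
`‖L_U u‖² + ‖(W+1)u‖² ≤ ‖(L_U + W + 1)u‖² + (c₁+c₂)·‖u‖²` in `ℓ²(X,μ)`. -/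
theorem okazawa_norm_estimate {X : Type*} [Countable X]
    (b : X → X → ℝ) (μ : X → ℝ)
    (hb_symm : ∀ x y, b x y = b y x)
    (hb_nonneg : ∀ x y, 0 ≤ b x y)
    (hb_loop : ∀ x, b x x = 0)
    (hb_sum : ∀ x, Summable fun z => b x z)
    (hμ_pos : ∀ x, 0 < μ x)
    (hFC : ∀ x, Summable fun y => μ y * (b x y / μ y) ^ 2)
    (U W : X → ℝ) (hU : ∀ x, 0 ≤ U x) (hW : ∀ x, 0 ≤ W x)
    (c₁ c₂ : ℝ) (hc₁ : 0 ≤ c₁) (hc₂ : 0 ≤ c₂)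
    (hgrad : ∀ x, gradSq b μ W x ≤ ENNReal.ofReal (c₁ + c₂ * W x)) :
    ∀ u : X → ℂ, (Function.support u).Finite →
      (∑' x, μ x * ‖lapV b μ U u x‖ ^ 2) +
          (∑' x, μ x * ‖((W x + 1 : ℝ) : ℂ) * u x‖ ^ 2) ≤
        (∑' x, μ x * ‖lapV b μ U u x + ((W x + 1 : ℝ) : ℂ) * u x‖ ^ 2) +
          (c₁ + c₂) * ∑' x, μ x * ‖u x‖ ^ 2 := by
  intro u hu
  classical
  obtain ⟨K, hKdef⟩ : ∃ K : Finset X, K = hu.toFinset := ⟨_, rfl⟩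
  have hK : ∀ x, x ∉ K → u x = 0 := by
    intro x hx
    rw [hKdef] at hx
    simpa using hx
  have sF := aux_summable b μ U hb_symm hb_sum hμ_pos hFC u K hK
  have zH : ∀ x, x ∉ K → μ x * ‖((W x + 1 : ℝ) : ℂ) * u x‖ ^ 2 = 0 := fun x hx => by
    simp [hK x hx]
  have sH : Summable fun x => μ x * ‖((W x + 1 : ℝ) : ℂ) * u x‖ ^ 2 :=
    summable_of_ne_finset_zero zH
  have zN : ∀ x, x ∉ K → μ x * ‖u x‖ ^ 2 = 0 := fun x hx => by simp [hK x hx]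
  have zC : ∀ x, x ∉ K →
      2 * ∑ y ∈ K, b x y * ((W x + 1) * (‖u x‖ ^ 2 - ‖u x‖ * ‖u y‖)) = 0 := fun x hx => by
    simp [hK x hx]
  have sC : Summable fun x =>
      2 * ∑ y ∈ K, b x y * ((W x + 1) * (‖u x‖ ^ 2 - ‖u x‖ * ‖u y‖)) :=
    summable_of_ne_finset_zero zC
  have sT : Summable fun x => μ x * ‖lapV b μ U u x + ((W x + 1 : ℝ) : ℂ) * u x‖ ^ 2 := by
    refine (summable_congr_cofinite ?_).mp sF
    have : ∀ᶠ x in Filter.cofinite, x ∉ K := K.finite_toSet.eventually_cofinite_notMem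
    filter_upwards [this] with x hx
    simp [hK x hx]
  have hle := ((sF.add sH).add sC).tsum_le_tsum
    (fun x => aux_point b μ U W hb_nonneg hb_sum hμ_pos hU hW u K hK x) sT
  rw [(sF.add sH).tsum_add sC, sF.tsum_add sH, tsum_eq_sum zC] at hle
  rw [tsum_eq_sum zN]
  have hpos : ∀ x, 0 < W x + 1 := fun x => by linarith [hW x]
  have hg : ∑ x ∈ K, ∑ y ∈ K,
      b x y * (((W x + 1) - (W y + 1)) ^ 2 / (W x + 1) * ‖u x‖ ^ 2 / 2)
      ≤ (c₁ + c₂) * (∑ x ∈ K, μ x * ‖u x‖ ^ 2) / 2 := by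
    rw [Finset.mul_sum, Finset.sum_div]
    refine Finset.sum_le_sum fun x _ => ?_
    have h := mul_le_mul_of_nonneg_right
      (aux_grad b μ W hb_nonneg hμ_pos hW c₁ c₂ hc₁ hc₂ hgrad K x)
      (by positivity : 0 ≤ ‖u x‖ ^ 2 / 2)
    rw [Finset.sum_mul] at h
    refine (le_of_eq ?_).trans (h.trans (le_of_eq (by ring)))
    exact Finset.sum_congr rfl fun y _ => by ring
  have hsw1 : ∑ x ∈ K, ∑ y ∈ K, b x y * ((W x + 1) * (‖u x‖ ^ 2 - ‖u x‖ * ‖u y‖))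
      = ∑ x ∈ K, ∑ y ∈ K, b x y * ((W y + 1) * (‖u y‖ ^ 2 - ‖u y‖ * ‖u x‖)) := by
    rw [Finset.sum_comm]
    exact Finset.sum_congr rfl fun x _ => Finset.sum_congr rfl fun y _ => by rw [hb_symm y x]
  have hsw2 : ∑ x ∈ K, ∑ y ∈ K,
        b x y * (((W x + 1) - (W y + 1)) ^ 2 / (W x + 1) * ‖u x‖ ^ 2 / 2)
      = ∑ x ∈ K, ∑ y ∈ K,
        b x y * (((W y + 1) - (W x + 1)) ^ 2 / (W y + 1) * ‖u y‖ ^ 2 / 2) := by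
    rw [Finset.sum_comm]
    exact Finset.sum_congr rfl fun x _ => Finset.sum_congr rfl fun y _ => by rw [hb_symm y x]
  have hnn : 0 ≤ ∑ x ∈ K, ∑ y ∈ K,
      (b x y * ((W x + 1) * (‖u x‖ ^ 2 - ‖u x‖ * ‖u y‖))
        + b x y * ((W y + 1) * (‖u y‖ ^ 2 - ‖u y‖ * ‖u x‖))
        + b x y * (((W x + 1) - (W y + 1)) ^ 2 / (W x + 1) * ‖u x‖ ^ 2 / 2)
        + b x y * (((W y + 1) - (W x + 1)) ^ 2 / (W y + 1) * ‖u y‖ ^ 2 / 2)) := by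
    refine Finset.sum_nonneg fun x _ => Finset.sum_nonneg fun y _ => ?_
    rw [← mul_add, ← mul_add, ← mul_add]
    exact mul_nonneg (hb_nonneg x y)
      (aux_pt (W x + 1) (W y + 1) ‖u x‖ ‖u y‖ (hpos x) (hpos y))
  simp only [Finset.sum_add_distrib] at hnn
  rw [← hsw1, ← hsw2] at hnn
  rw [← Finset.mul_sum] at hle
  linarith
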